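/- Consider the serial dictatorship mechanism with minimum quotas (MMQ): users are processed in decreasing order of a strict master list ≻_ML; in phase 1, each user is assigned to its most preferred base station whose load is below its maximum quota, continuing until the number of remaining unassigned users equals ∑_n max(q_min(n) − κ(n), 0); in phase 2, each remaining user (in master-list order) is assigned to its most preferred base station whose load is strictly below its minimum quota. If 0 ≤ q_min(n) ≤ q_max(n) for all n and ∑_n q_min(n) ≤ |M| ≤ ∑_n q_max(n), then MMQ terminates with a feasible matching, i.e., every user is assigned to exactly one base station and q_min(n) ≤ κ(n) ≤ q_max(n) for all n. -/

import Mathlib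

/-- Load of base station `n` under a partial assignment `π`. -/
def bsLoad {M N : Type*} [Fintype M] [DecidableEq N] (π : M → Option N) (n : N) : ℕ :=
  (Finset.univ.filter (fun m => π m = some n)).card

/-- The MMQ (matching with minimum quotas) serial-dictatorship run: users are processed
in master-list order; while the number of remaining users exceeds the total unmet minimum
quota (phase 1), each user goes to its most preferred (lowest `rank`) base station whose
load is below its maximum quota; once the remaining users exactly fill the unmet minimum
quotas (phase 2), each user goes to its most preferred base station whose load is below
its minimum quota. -/
noncomputable def mmqRun {M N : Type*} [Fintype M] [Fintype N] [DecidableEq M] [DecidableEq N]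
    (qmin qmax : N → ℕ) (rank : M → N → ℕ) :
    List M → (M → Option N) → (M → Option N)
  | [], π => π
  | m :: rest, π =>
      let κ := bsLoad π
      let deficit := ∑ n : N, (qmin n - κ n)
      let allowed : Finset N :=
        if rest.length + 1 = deficit then Finset.univ.filter (fun n => κ n < qmin n)
        else Finset.univ.filter (fun n => κ n < qmax n)
      match allowed.toList.argmin (rank m) with
      | some n => mmqRun qmin qmax rank rest (Function.update π m (some n))
      | none => mmqRun qmin qmax rank rest π

theorem bsLoad_update {M N : Type*} [Fintype M] [DecidableEq M] [DecidableEq N]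
    {π : M → Option N} {m : M} (hm : π m = none) (n k : N) :
    bsLoad (Function.update π m (some n)) k = bsLoad π k + if k = n then 1 else 0 := by
  unfold bsLoad
  split_ifs with h
  · subst h
    rw [← Finset.card_insert_of_notMem (a := m) (by simp [hm])]
    congr 1
    ext x
    by_cases hx : x = m <;> simp [hx]
  · rw [Nat.add_zero]
    congr 1
    ext x
    by_cases hx : x = m
    · subst hx
      simp [hm, Ne.symm h]
    · simp [hx]

/-- Assigning an unassigned user to a base station below quota lowers the total unmet quota
by one. -/
theorem sum_sub_bsLoad_update_add_one {M N : Type*} [Fintype M] [Fintype N] [DecidableEq M]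
    [DecidableEq N] {π : M → Option N} {m : M} (hm : π m = none) {q : N → ℕ} {n : N}
    (hn : bsLoad π n < q n) :
    ∑ k, (q k - bsLoad (Function.update π m (some n)) k) + 1 = ∑ k, (q k - bsLoad π k) := by
  have hk (k : N) : q k - bsLoad π k =
      (q k - bsLoad (Function.update π m (some n)) k) + if k = n then 1 else 0 := by
    rw [bsLoad_update hm]
    split_ifs with h
    · subst h
      omega
    · omega
  simp [Finset.sum_congr rfl fun k _ => hk k, Finset.sum_add_distrib]

/-- Total unmet quota does not grow when an unassigned user is assigned. -/
theorem sum_sub_bsLoad_update_le {M N : Type*} [Fintype M] [Fintype N] [DecidableEq M]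
    [DecidableEq N] {π : M → Option N} {m : M} (hm : π m = none) (q : N → ℕ) (n : N) :
    ∑ k, (q k - bsLoad (Function.update π m (some n)) k) ≤ ∑ k, (q k - bsLoad π k) := by
  refine Finset.sum_le_sum fun k _ => ?_
  rw [bsLoad_update hm]
  omega

theorem exists_bsLoad_lt_of_sum_sub_pos {M N : Type*} [Fintype M] [Fintype N] [DecidableEq N]
    {π : M → Option N} {q : N → ℕ} (h : 0 < ∑ n, (q n - bsLoad π n)) :
    ∃ n, bsLoad π n < q n := by
  obtain ⟨n, -, hn⟩ := Finset.exists_ne_zero_of_sum_ne_zero h.ne'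
  exact ⟨n, by omega⟩

/-- While some maximum quota is not exhausted, MMQ assigns the next user to a base station below
its maximum quota, and below its minimum quota in phase 2. -/
theorem exists_mmqRun_cons_eq {M N : Type*} [Fintype M] [Fintype N] [DecidableEq M]
    [DecidableEq N] {qmin qmax : N → ℕ} (rank : M → N → ℕ) (hq : ∀ n, qmin n ≤ qmax n)
    (m : M) (rest : List M) (π : M → Option N) (hpos : 0 < ∑ n, (qmax n - bsLoad π n)) :
    ∃ n, bsLoad π n < qmax n ∧
      (rest.length + 1 = ∑ k, (qmin k - bsLoad π k) → bsLoad π n < qmin n) ∧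
      mmqRun qmin qmax rank (m :: rest) π =
        mmqRun qmin qmax rank rest (Function.update π m (some n)) := by
  rw [mmqRun]
  set allowed : Finset N :=
    if rest.length + 1 = ∑ k, (qmin k - bsLoad π k) then
      Finset.univ.filter (fun k => bsLoad π k < qmin k)
    else Finset.univ.filter (fun k => bsLoad π k < qmax k) with hallowed
  have hne : allowed.Nonempty := by
    rw [hallowed]
    split_ifs with h
    · obtain ⟨n, hn⟩ := exists_bsLoad_lt_of_sum_sub_pos (π := π) (q := qmin)
        (h ▸ Nat.succ_pos _)
      exact ⟨n, by simpa using hn⟩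
    · obtain ⟨n, hn⟩ := exists_bsLoad_lt_of_sum_sub_pos hpos
      exact ⟨n, by simpa using hn⟩
  cases harg : allowed.toList.argmin (rank m) with
  | none =>
    rw [List.argmin_eq_none, Finset.toList_eq_nil] at harg
    exact absurd harg hne.ne_empty
  | some n =>
    have hmem : n ∈ allowed := Finset.mem_toList.mp (List.argmin_mem harg)
    rw [hallowed] at hmem
    refine ⟨n, ?_, fun h => ?_, rfl⟩
    · split_ifs at hmem
      · exact (Finset.mem_filter.mp hmem).2.trans_le (hq n)
      · exact (Finset.mem_filter.mp hmem).2
    · rw [if_pos h] at hmem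
      exact (Finset.mem_filter.mp hmem).2

/-- From any partial assignment that can still be completed, MMQ reaches a feasible matching. -/
theorem mmqRun_feasible {M N : Type*} [Fintype M] [Fintype N] [DecidableEq M] [DecidableEq N]
    {qmin qmax : N → ℕ} (rank : M → N → ℕ) (hq : ∀ n, qmin n ≤ qmax n) (l : List M)
    (hl : l.Nodup) (π : M → Option N) (hπ : ∀ m, π m = none ↔ m ∈ l)
    (hmax : ∀ n, bsLoad π n ≤ qmax n)
    (hlow : ∑ n, (qmin n - bsLoad π n) ≤ l.length)
    (hhigh : l.length ≤ ∑ n, (qmax n - bsLoad π n)) :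
    (∀ m, ∃ n, mmqRun qmin qmax rank l π m = some n) ∧
      ∀ n, qmin n ≤ bsLoad (mmqRun qmin qmax rank l π) n ∧
        bsLoad (mmqRun qmin qmax rank l π) n ≤ qmax n := by
  induction l generalizing π with
  | nil =>
    rw [mmqRun]
    refine ⟨fun m => Option.ne_none_iff_exists'.mp (by simp [hπ]), fun n => ⟨?_, hmax n⟩⟩
    have hz := Finset.sum_eq_zero_iff.mp (Nat.le_zero.mp hlow) n (Finset.mem_univ n)
    omega
  | cons m rest ih =>
    rw [List.length_cons] at hlow hhigh
    obtain ⟨n, hn, hphase, hrun⟩ := exists_mmqRun_cons_eq (qmin := qmin) rank hq m rest π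
      (by omega)
    have hm : π m = none := by simp [hπ]
    rw [hrun]
    obtain ⟨hnot, hrest⟩ := List.nodup_cons.mp hl
    refine ih hrest _ (fun x => ?_) (fun k => ?_) ?_ ?_
    · by_cases hx : x = m
      · simp [hx, hnot]
      · simp [hx, hπ]
    · rw [bsLoad_update hm]
      split_ifs with h
      · exact h ▸ hn
      · exact hmax k
    · by_cases h : rest.length + 1 = ∑ k, (qmin k - bsLoad π k)
      · have := sum_sub_bsLoad_update_add_one hm (hphase h)
        omega
      · have := sum_sub_bsLoad_update_le hm qmin n
        omega
    · have := sum_sub_bsLoad_update_add_one hm hn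
      omega

/-- If quotas satisfy `qmin n ≤ qmax n` and `∑ qmin ≤ |M| ≤ ∑ qmax`, the MMQ algorithm
terminates with a feasible matching: every user is assigned to exactly one base station
and every base station's load lies between its minimum and maximum quotas. -/
theorem mmq_terminates_feasible {M N : Type*} [Fintype M] [Fintype N]
    [DecidableEq M] [DecidableEq N]
    (qmin qmax : N → ℕ) (rank : M → N → ℕ)
    (hrank : ∀ m : M, Function.Injective (rank m))
    (hq : ∀ n, qmin n ≤ qmax n)
    (hlow : ∑ n : N, qmin n ≤ Fintype.card M)
    (hhigh : Fintype.card M ≤ ∑ n : N, qmax n)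
    (ml : List M) (hml : ml.Nodup) (hfull : ∀ m : M, m ∈ ml) :
    (∀ m : M, ∃ n : N, mmqRun qmin qmax rank ml (fun _ => none) m = some n) ∧
    (∀ n : N, qmin n ≤ bsLoad (mmqRun qmin qmax rank ml (fun _ => none)) n ∧
      bsLoad (mmqRun qmin qmax rank ml (fun _ => none)) n ≤ qmax n) := by
  have hload (n : N) : bsLoad (fun _ : M => none) n = 0 := by simp [bsLoad]
  have hlen : ml.length = Fintype.card M := by
    rw [← List.toFinset_card_of_nodup hml, ← Finset.card_univ]
    congr 1
    ext m
    simp [hfull]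
  exact mmqRun_feasible rank hq ml hml _ (by simp [hfull]) (by simp [hload])
    (by simpa [hload, hlen] using hlow) (by simpa [hload, hlen] using hhigh)
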